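/- Every AIR tilting subcategory of d-H is quasi-tilting. -/

import Mathlib

open CategoryTheory CategoryTheory.Limits CategoryTheory.Pretriangulated

universe v u

namespace PaperAIR

variable {C : Type u} [Category.{v} C] [Preadditive C] [HasZeroObject C]
  [HasShift C ℤ] [∀ n : ℤ, (shiftFunctor C n).Additive] [Pretriangulated C]

/-- `f : X ⟶ Y` is a right `𝒳`-approximation of `Y` (relative to `𝒳 ∋ X`). -/
def IsRightApprox (𝒳 : Set C) {X Y : C} (f : X ⟶ Y) : Prop :=
  X ∈ 𝒳 ∧ ∀ X' ∈ 𝒳, ∀ g : X' ⟶ Y, ∃ h : X' ⟶ X, h ≫ f = g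

/-- `𝒳` is contravariantly finite in `C`: every object admits a right `𝒳`-approximation. -/
def ContravariantlyFinite (𝒳 : Set C) : Prop :=
  ∀ Y : C, ∃ (X : C) (f : X ⟶ Y), IsRightApprox 𝒳 f

/-- `𝒳` is contravariantly finite in the full subcategory `𝒞`. -/
def ContravariantlyFiniteIn (𝒞 𝒳 : Set C) : Prop :=
  ∀ Y ∈ 𝒞, ∃ (X : C) (f : X ⟶ Y), IsRightApprox 𝒳 f

/-- `𝒮` is presilting: `Hom(𝒮, 𝒮[i]) = 0` for all `i > 0`. -/
def IsPresilting (𝒮 : Set C) : Prop :=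
  ∀ X ∈ 𝒮, ∀ Y ∈ 𝒮, ∀ i : ℤ, 0 < i → ∀ f : X ⟶ Y⟦i⟧, f = 0

/-- a (strictly full) triangulated subcategory, given by its class of objects. -/
structure IsTriangSub (T : Set C) : Prop where
  iso_closed : ∀ (X Y : C), (X ≅ Y) → X ∈ T → Y ∈ T
  zero_mem : ∀ X : C, IsZero X → X ∈ T
  shift_mem : ∀ X ∈ T, X⟦(1 : ℤ)⟧ ∈ T
  unshift_mem : ∀ X ∈ T, X⟦(-1 : ℤ)⟧ ∈ T
  ext_mem : ∀ (T' : Triangle C), T' ∈ (distTriang C) → T'.obj₁ ∈ T → T'.obj₃ ∈ T → T'.obj₂ ∈ T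

/-- a thick subcategory: a triangulated subcategory closed under direct summands. -/
structure IsThickSub (T : Set C) extends IsTriangSub T : Prop where
  summand_mem : ∀ (X Y : C) (i : X ⟶ Y) (r : Y ⟶ X), i ≫ r = 𝟙 X → Y ∈ T → X ∈ T

/-- the smallest thick subcategory containing `𝒮`. -/
def thickClosure (𝒮 : Set C) : Set C :=
  {X | ∀ T : Set C, IsThickSub T → 𝒮 ⊆ T → X ∈ T}

/-- `𝒮` is a silting subcategory of `C`: presilting, and the smallest triangulated
subcategory containing `𝒮` is `C` itself. -/
def IsSilting (𝒮 : Set C) : Prop :=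
  IsPresilting 𝒮 ∧ ∀ T : Set C, IsTriangSub T → 𝒮 ⊆ T → ∀ X : C, X ∈ T

/-- `𝒮` is a silting subcategory of the (thick, triangulated) subcategory `𝒦`:
presilting, and the smallest triangulated subcategory containing `𝒮` is `𝒦`. -/
def IsSiltingIn (𝒦 𝒮 : Set C) : Prop :=
  𝒮 ⊆ 𝒦 ∧ IsPresilting 𝒮 ∧ ∀ T : Set C, IsTriangSub T → 𝒮 ⊆ T → 𝒦 ⊆ T

/-- the shift `𝒮[n]` of a class of objects (closed under isomorphism). -/
def shiftSet (𝒮 : Set C) (n : ℤ) : Set C :=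
  {X | ∃ Y ∈ 𝒮, Nonempty (X ≅ Y⟦n⟧)}

/-- `𝒜 ∗ ℬ`: objects `Z` fitting in a triangle `A → Z → B → A[1]` with `A ∈ 𝒜`, `B ∈ ℬ`. -/
def star (𝒜 ℬ : Set C) : Set C :=
  {Z | ∃ (A B : C) (_ : A ∈ 𝒜) (_ : B ∈ ℬ) (f : A ⟶ Z) (g : Z ⟶ B) (h : B ⟶ A⟦(1 : ℤ)⟧),
      Triangle.mk f g h ∈ (distTriang C)}

/-- `𝒮^{[p, p+n]} = 𝒮[p] ∗ 𝒮[p+1] ∗ ⋯ ∗ 𝒮[p+n]`. -/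
def intervalFrom (𝒮 : Set C) (p : ℤ) : ℕ → Set C
  | 0 => shiftSet 𝒮 p
  | n + 1 => star (shiftSet 𝒮 p) (intervalFrom 𝒮 (p + 1) n)

/-- `C_𝒳^{≤ 0}`: objects `Y` with `Hom(𝒳, Y[i]) = 0` for all `i > 0`. -/
def leZeroSet (𝒳 : Set C) : Set C :=
  {Y | ∀ X ∈ 𝒳, ∀ i : ℤ, 0 < i → ∀ f : X ⟶ Y⟦i⟧, f = 0}

/-- `C_𝒳^{≥ 0}`: objects `Y` with `Hom(𝒳, Y[i]) = 0` for all `i < 0`. -/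
def geZeroSet (𝒳 : Set C) : Set C :=
  {Y | ∀ X ∈ 𝒳, ∀ i : ℤ, i < 0 → ∀ f : X ⟶ Y⟦i⟧, f = 0}

/-- `(L, G)` is a `t`-structure (with `L = D^{≤0}`, `G = D^{≥0}`). -/
structure IsTStr (L G : Set C) : Prop where
  iso_le : ∀ (X Y : C), (X ≅ Y) → X ∈ L → Y ∈ L
  iso_ge : ∀ (X Y : C), (X ≅ Y) → X ∈ G → Y ∈ G
  shift_le : ∀ X ∈ L, X⟦(1 : ℤ)⟧ ∈ L
  shift_ge : ∀ X ∈ G, X⟦(-1 : ℤ)⟧ ∈ G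
  hom_zero : ∀ X ∈ L, ∀ Y : C, Y⟦(1 : ℤ)⟧ ∈ G → ∀ f : X ⟶ Y, f = 0
  exists_tri : ∀ X : C, ∃ (A B : C) (f : A ⟶ X) (g : X ⟶ B) (h : B ⟶ A⟦(1 : ℤ)⟧),
      Triangle.mk f g h ∈ (distTriang C) ∧ A ∈ L ∧ B⟦(1 : ℤ)⟧ ∈ G

/-- the `d`-extended heart `d`-`H = D^{≤0} ∩ D^{≥ -d+1}` of the `t`-structure
`(D_P^{≤0}, D_P^{≥0})` associated with `P`. -/
def extHeart (P : Set C) (d : ℕ) : Set C :=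
  {X | X ∈ leZeroSet P ∧ X⟦(1 - (d : ℤ))⟧ ∈ geZeroSet P}

/-- an extriangle `A → B → Z` in the `d`-extended heart. -/
def Extriangle (P : Set C) (d : ℕ) (A B Z : C) : Prop :=
  A ∈ extHeart P d ∧ B ∈ extHeart P d ∧ Z ∈ extHeart P d ∧
    ∃ (f : A ⟶ B) (g : B ⟶ Z) (h : Z ⟶ A⟦(1 : ℤ)⟧), Triangle.mk f g h ∈ (distTriang C)

/-- `Fac_s(𝒳)`: the `s`-factors of `𝒳` inside the `d`-extended heart. -/
def Fac (P : Set C) (d : ℕ) (𝒳 : Set C) : ℕ → Set C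
  | 0 => extHeart P d
  | s + 1 => {Z | ∃ Z' ∈ Fac P d 𝒳 s, ∃ B ∈ 𝒳, Extriangle P d Z' B Z}

/-- `T(𝒮) = {X ∈ d-H ∣ Hom(𝒮, X[i]) = 0 for i > 0}`. -/
def TClass (P : Set C) (d : ℕ) (𝒮 : Set C) : Set C :=
  {X | X ∈ extHeart P d ∧ ∀ A ∈ 𝒮, ∀ i : ℤ, 0 < i → ∀ f : A ⟶ X⟦i⟧, f = 0}

/-- `F(𝒮) = {X ∈ d-H ∣ Hom(𝒮, X[i]) = 0 for i ≤ 0}`. -/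
def FClass (P : Set C) (d : ℕ) (𝒮 : Set C) : Set C :=
  {X | X ∈ extHeart P d ∧ ∀ A ∈ 𝒮, ∀ i : ℤ, i ≤ 0 → ∀ f : A ⟶ X⟦i⟧, f = 0}

/-- `(𝒯, ℱ)` is an `s`-torsion pair in the `d`-extended heart. -/
def IsSTorsionPair (P : Set C) (d : ℕ) (𝒯 ℱ : Set C) : Prop :=
  (∀ T ∈ 𝒯, ∀ F ∈ ℱ, ∀ f : T ⟶ F, f = 0) ∧
  (∀ T ∈ 𝒯, ∀ F ∈ ℱ, ∀ f : T ⟶ F⟦(-1 : ℤ)⟧, f = 0) ∧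
  (∀ X ∈ extHeart P d, ∃ (T' : C) (_ : T' ∈ 𝒯) (F' : C) (_ : F' ∈ ℱ), Extriangle P d T' X F')

/-- `M` is (a representative of) `H^{[-d+1,0]}(S)`: there is a triangle
`W → S → M → W[1]` with `W ∈ D^{≤ -d}` and `M ∈ d-H`. -/
def IsHTrunc (P : Set C) (d : ℕ) (S M : C) : Prop :=
  M ∈ extHeart P d ∧
    ∃ (W : C) (f : W ⟶ S) (g : S ⟶ M) (h : M ⟶ W⟦(1 : ℤ)⟧),
      Triangle.mk f g h ∈ (distTriang C) ∧ W⟦-(d : ℤ)⟧ ∈ leZeroSet P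

/-- `H^{[-d+1,0]}(𝒮)` as a class of objects. -/
def hTruncSet (P : Set C) (d : ℕ) (𝒮 : Set C) : Set C :=
  {M | ∃ S ∈ 𝒮, IsHTrunc P d S M}

/-- the additive closure of a class of objects: closure under finite direct sums
(expressed via binary biproduct diagrams and zero objects) and direct summands. -/
inductive AddClos (𝒮 : Set C) : C → Prop
  | of (X : C) (hX : X ∈ 𝒮) : AddClos 𝒮 X
  | zero (X : C) (hX : IsZero X) : AddClos 𝒮 X
  | biprod (X Y Z : C) (i₁ : X ⟶ Z) (i₂ : Y ⟶ Z) (p₁ : Z ⟶ X) (p₂ : Z ⟶ Y)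
      (h₁ : i₁ ≫ p₁ = 𝟙 X) (h₂ : i₂ ≫ p₂ = 𝟙 Y) (h₁₂ : i₁ ≫ p₂ = 0) (h₂₁ : i₂ ≫ p₁ = 0)
      (htot : p₁ ≫ i₁ + p₂ ≫ i₂ = 𝟙 Z) (hX : AddClos 𝒮 X) (hY : AddClos 𝒮 Y) : AddClos 𝒮 Z
  | summand (X Y : C) (i : X ⟶ Y) (r : Y ⟶ X) (hir : i ≫ r = 𝟙 X) (hY : AddClos 𝒮 Y) :
      AddClos 𝒮 X

/-- `add 𝒮` as a set. -/
def addSet (𝒮 : Set C) : Set C := {X | AddClos 𝒮 X}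

/-- `𝒮` is a `P`-presentation of `ℳ ⊆ d-H`: a `(d+1)`-term subcategory of `K`
with `add H^{[-d+1,0]}(𝒮) = ℳ`. -/
def IsPPresentation (P : Set C) (d : ℕ) (ℳ 𝒮 : Set C) : Prop :=
  𝒮 ⊆ intervalFrom P 0 d ∧ addSet (hTruncSet P d 𝒮) = ℳ

/-- `ℳ` is AIR tilting with respect to its `P`-presentation `𝒮`. -/
def IsAIRTiltingWrt (P : Set C) (d : ℕ) (ℳ 𝒮 : Set C) : Prop :=
  IsPPresentation P d ℳ 𝒮 ∧ ContravariantlyFinite 𝒮 ∧ TClass P d 𝒮 = Fac P d ℳ d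

/-- `ℳ` is AIR tilting. -/
def IsAIRTilting (P : Set C) (d : ℕ) (ℳ : Set C) : Prop :=
  ∃ 𝒮 : Set C, IsAIRTiltingWrt P d ℳ 𝒮

/-- `ℳ` is a quasi-tilting subcategory of the `d`-extended heart. -/
def IsQuasiTilting (P : Set C) (d : ℕ) (ℳ : Set C) : Prop :=
  (∀ M ∈ ℳ, ∀ X ∈ Fac P d ℳ d, ∀ f : M ⟶ X⟦(1 : ℤ)⟧, f = 0) ∧
  Fac P d ℳ d = Fac P d ℳ (d + 1)

/-- `M ∈ d-H` has projective dimension at most `m`. -/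
def ProjDimLE (P : Set C) (d : ℕ) : ℕ → C → Prop
  | 0, M => M ∈ P
  | m + 1, M => ∃ (Z Q : C), Q ∈ P ∧ ProjDimLE P d m Z ∧ Extriangle P d Z Q M

/-- `ℳ` is a tilting subcategory of the `d`-extended heart. -/
def IsTilting (P : Set C) (d : ℕ) (ℳ : Set C) : Prop :=
  (∀ M ∈ ℳ, ProjDimLE P d d M) ∧
  (∀ M ∈ ℳ, ∀ M' ∈ ℳ, ∀ i : ℤ, 0 < i → ∀ f : M ⟶ M'⟦i⟧, f = 0) ∧
  (∀ Q ∈ P, ∃ (r : ℕ) (Y : ℕ → C) (M : ℕ → C), Y 0 = Q ∧ Y r ∈ ℳ ∧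
      ∀ i < r, M i ∈ ℳ ∧ Extriangle P d (Y i) (M i) (Y (i + 1)))

/-- `ℳ` is an `E`-universal subcategory of the `d`-extended heart. -/
def EUniversal (P : Set C) (d : ℕ) (ℳ : Set C) : Prop :=
  ∀ X ∈ extHeart P d, ∃ (Y M : C) (_ : M ∈ ℳ) (f : X ⟶ Y) (g : Y ⟶ M)
      (h : M ⟶ X⟦(1 : ℤ)⟧), Triangle.mk f g h ∈ (distTriang C) ∧ Y ∈ extHeart P d ∧
      ∀ M' ∈ ℳ, ∀ e : M' ⟶ X⟦(1 : ℤ)⟧, ∃ φ : M' ⟶ M, φ ≫ h = e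

/-- `Hom(A, X[i]) = 0`. -/
def HomZero (A X : C) (i : ℤ) : Prop := ∀ f : A ⟶ X⟦i⟧, f = 0

namespace HomZero

lemma of_retract {A X Y : C} {k : ℤ} (i : X ⟶ Y) (r : Y ⟶ X) (hir : i ≫ r = 𝟙 X)
    (h : HomZero A Y k) : HomZero A X k := by
  intro f
  have h₁ : f ≫ i⟦k⟧' = 0 := h _
  calc f = f ≫ (i ≫ r)⟦k⟧' := by rw [hir]; simp
    _ = 0 := by rw [Functor.map_comp, reassoc_of% h₁, zero_comp]

lemma of_iso {A X Y : C} {k : ℤ} (e : X ≅ Y) (h : HomZero A Y k) : HomZero A X k :=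
  h.of_retract e.hom e.inv e.hom_inv_id

lemma of_isZero {A X : C} (k : ℤ) (hX : IsZero X) : HomZero A X k :=
  fun _ => ((shiftFunctor C k).map_isZero hX).eq_of_tgt _ _

lemma of_biprod {A X Y Z : C} {k : ℤ} {i₁ : X ⟶ Z} {i₂ : Y ⟶ Z} {p₁ : Z ⟶ X} {p₂ : Z ⟶ Y}
    (htot : p₁ ≫ i₁ + p₂ ≫ i₂ = 𝟙 Z) (hX : HomZero A X k) (hY : HomZero A Y k) :
    HomZero A Z k := by
  intro f
  have h₁ : f ≫ p₁⟦k⟧' = 0 := hX _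
  have h₂ : f ≫ p₂⟦k⟧' = 0 := hY _
  calc f = f ≫ (p₁ ≫ i₁ + p₂ ≫ i₂)⟦k⟧' := by rw [htot]; simp
    _ = 0 := by
      rw [Functor.map_add, Functor.map_comp, Functor.map_comp, Preadditive.comp_add,
        reassoc_of% h₁, reassoc_of% h₂, zero_comp, zero_comp, add_zero]

lemma shift_iff {A X : C} {a b c : ℤ} (h : a + b = c) :
    HomZero A (X⟦a⟧) b ↔ HomZero A X c := by
  have e := (shiftFunctorAdd' C a b c h).app X
  constructor
  · intro H f
    rw [← cancel_mono e.hom, zero_comp]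
    exact H _
  · intro H f
    rw [← cancel_mono e.inv, zero_comp]
    exact H _

end HomZero

lemma exists_lift_shift_obj₂ {T : Triangle C} (hT : T ∈ distTriang C) {A : C} (k : ℤ)
    (f : A ⟶ T.obj₂⟦k⟧) (hf : f ≫ T.mor₂⟦k⟧' = 0) : ∃ g : A ⟶ T.obj₁⟦k⟧, g ≫ T.mor₁⟦k⟧' = f := by
  obtain ⟨g, hg⟩ := Triangle.coyoneda_exact₂ _ (Triangle.shift_distinguished T hT k) f
    (by
      change f ≫ (k.negOnePow • T.mor₂⟦k⟧') = 0
      rw [Linear.comp_units_smul, hf, smul_zero])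
  change A ⟶ T.obj₁⟦k⟧ at g
  change f = g ≫ (k.negOnePow • T.mor₁⟦k⟧') at hg
  exact ⟨k.negOnePow • g, by rw [hg, Linear.comp_units_smul, Linear.units_smul_comp]⟩

namespace HomZero

lemma obj₂ {T : Triangle C} (hT : T ∈ distTriang C) {A : C} {k : ℤ}
    (h₁ : HomZero A T.obj₁ k) (h₃ : HomZero A T.obj₃ k) : HomZero A T.obj₂ k := by
  intro f
  obtain ⟨g, rfl⟩ := exists_lift_shift_obj₂ hT k f (h₃ _)
  rw [h₁ g, zero_comp]

lemma obj₃ {T : Triangle C} (hT : T ∈ distTriang C) {A : C} {k : ℤ}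
    (h₂ : HomZero A T.obj₂ k) (h₁ : HomZero A T.obj₁ (k + 1)) : HomZero A T.obj₃ k :=
  obj₂ (rot_of_distTriang _ hT) h₂ ((shift_iff (add_comm 1 k)).2 h₁)

lemma obj₁ {T : Triangle C} (hT : T ∈ distTriang C) {A : C} {k : ℤ}
    (h₃ : HomZero A T.obj₃ (k - 1)) (h₂ : HomZero A T.obj₂ k) : HomZero A T.obj₁ k :=
  obj₂ (inv_rot_of_distTriang _ hT) ((shift_iff (by ring)).2 h₃) h₂

/-- If every `A ⟶ T.obj₃` lifts to `T.obj₂` and `Hom(A, T.obj₂[1]) = 0`,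
then `Hom(A, T.obj₁[1]) = 0`. -/
lemma obj₁_of_lift {T : Triangle C} (hT : T ∈ distTriang C) {A : C}
    (h₂ : HomZero A T.obj₂ 1)
    (h : ∀ f : A ⟶ T.obj₃, ∃ g : A ⟶ T.obj₂, g ≫ T.mor₂ = f) : HomZero A T.obj₁ 1 := by
  intro f
  obtain ⟨g, rfl⟩ := Triangle.coyoneda_exact₁ T hT f (h₂ _)
  obtain ⟨g, rfl⟩ := h g
  rw [Category.assoc, comp_distTriang_mor_zero₂₃ T hT, comp_zero]

end HomZero

lemma homZero_of_addClos {𝒮 : Set C} {A : C} {k : ℤ} (h : ∀ X ∈ 𝒮, HomZero A X k) {X : C}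
    (hX : AddClos 𝒮 X) : HomZero A X k := by
  induction hX with
  | of X hX => exact h X hX
  | zero X hX => exact .of_isZero k hX
  | biprod X Y Z i₁ i₂ p₁ p₂ _ _ _ _ htot _ _ hX hY => exact .of_biprod htot hX hY
  | summand X Y i r hir _ hY => exact .of_retract i r hir hY

lemma mem_extHeart_iff {P : Set C} {d : ℕ} {X : C} :
    X ∈ extHeart P d ↔ (∀ A ∈ P, ∀ k : ℤ, 0 < k → HomZero A X k) ∧
      ∀ A ∈ P, ∀ k : ℤ, k < 1 - d → HomZero A X k := by
  refine and_congr Iff.rfl ⟨fun h A hA k hk => ?_, fun h A hA i hi => ?_⟩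
  · exact (HomZero.shift_iff (add_sub_cancel _ _)).1 (h A hA (k - (1 - d)) (by omega))
  · exact (HomZero.shift_iff rfl).2 (h A hA (1 - d + i) (by omega))

lemma zero_mem_extHeart {P : Set C} {d : ℕ} {X : C} (hX : IsZero X) : X ∈ extHeart P d :=
  mem_extHeart_iff.2 ⟨fun _ _ k _ => .of_isZero k hX, fun _ _ k _ => .of_isZero k hX⟩

lemma addSet_subset_extHeart {P : Set C} {d : ℕ} {𝒮 : Set C} (h : 𝒮 ⊆ extHeart P d) :
    addSet 𝒮 ⊆ extHeart P d := fun _ hX => mem_extHeart_iff.2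
  ⟨fun A hA k hk => homZero_of_addClos (fun _ hY => (mem_extHeart_iff.1 (h hY)).1 A hA k hk) hX,
    fun A hA k hk => homZero_of_addClos (fun _ hY => (mem_extHeart_iff.1 (h hY)).2 A hA k hk) hX⟩

open ZeroObject in
lemma zero_mem_fac {P : Set C} {d : ℕ} {𝒳 : Set C} (h0 : (0 : C) ∈ 𝒳) (s : ℕ) :
    (0 : C) ∈ Fac P d 𝒳 s := by
  have hz : (0 : C) ∈ extHeart P d := zero_mem_extHeart (isZero_zero C)
  induction s with
  | zero => exact hz
  | succ s ih =>
    exact ⟨0, ih, 0, h0, hz, hz, hz, 𝟙 0, 0, 0, contractible_distinguished 0⟩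

open ZeroObject in
lemma subset_fac {P : Set C} {d : ℕ} {𝒳 : Set C} (h0 : (0 : C) ∈ 𝒳) (h : 𝒳 ⊆ extHeart P d)
    (s : ℕ) : 𝒳 ⊆ Fac P d 𝒳 s := by
  intro X hX
  cases s with
  | zero => exact h hX
  | succ s =>
    exact ⟨0, zero_mem_fac h0 s, X, hX, zero_mem_extHeart (isZero_zero C), h hX, h hX,
      0, 𝟙 X, 0, contractible_distinguished₁ X⟩

lemma fac_succ_subset {P : Set C} {d : ℕ} {𝒳 : Set C} (s : ℕ) :
    Fac P d 𝒳 (s + 1) ⊆ Fac P d 𝒳 s := by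
  induction s with
  | zero => rintro Z ⟨_, _, _, _, _, _, hZ, _⟩; exact hZ
  | succ s ih => rintro Z ⟨Z', hZ', B, hB, h⟩; exact ⟨Z', ih hZ', B, hB, h⟩

lemma intervalFrom_subset_leZeroSet {P : Set C} (hP : IsPresilting P) (n : ℕ) :
    ∀ p : ℤ, 0 ≤ p → intervalFrom P p n ⊆ leZeroSet P := by
  have hs : ∀ p : ℤ, 0 ≤ p → shiftSet P p ⊆ leZeroSet P := by
    rintro p hp X ⟨Y, hY, ⟨e⟩⟩ A hA i hi
    exact HomZero.of_iso e ((HomZero.shift_iff rfl).2 (hP A hA Y hY (p + i) (by omega)))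
  induction n with
  | zero => exact hs
  | succ n ih =>
    rintro p hp X ⟨A, B, hA, hB, f, g, h, hT⟩ Q hQ i hi
    exact HomZero.obj₂ hT (hs p hp hA Q hQ i hi) (ih (p + 1) (by omega) hB Q hQ i hi)

lemma hom_eq_zero_of_tStr {P : Set C} {d : ℕ} (hP : IsTStr (leZeroSet P) (geZeroSet P))
    {W X : C} (hW : W⟦-(d : ℤ)⟧ ∈ leZeroSet P) (hX : X ∈ extHeart P d) (f : W ⟶ X) : f = 0 := by
  apply (shiftFunctor C (-(d : ℤ))).map_injective
  rw [Functor.map_zero]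
  exact hP.hom_zero _ hW _
    (hP.iso_ge _ _ ((shiftFunctorAdd' C (-(d : ℤ)) 1 (1 - d) (by ring)).app X) hX.2) _

lemma exists_isHTrunc {P : Set C} {d : ℕ} (hP : IsTStr (leZeroSet P) (geZeroSet P))
    {S : C} (hS : S ∈ leZeroSet P) : ∃ M : C, IsHTrunc P d S M := by
  obtain ⟨A, B, f, g, h, hT, hA, hB⟩ := hP.exists_tri (S⟦-(d : ℤ)⟧)
  let e : (S⟦-(d : ℤ)⟧)⟦(d : ℤ)⟧ ≅ S := (shiftFunctorCompIsoId C (-(d : ℤ)) d (by simp)).app S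
  obtain ⟨f', g', h', hT'⟩ : ∃ (f' : A⟦(d : ℤ)⟧ ⟶ (S⟦-(d : ℤ)⟧)⟦(d : ℤ)⟧)
      (g' : (S⟦-(d : ℤ)⟧)⟦(d : ℤ)⟧ ⟶ B⟦(d : ℤ)⟧) (h' : B⟦(d : ℤ)⟧ ⟶ (A⟦(d : ℤ)⟧)⟦(1 : ℤ)⟧),
      Triangle.mk f' g' h' ∈ distTriang C := ⟨_, _, _, Triangle.shift_distinguished _ hT (d : ℤ)⟩
  have hT'' : Triangle.mk (f' ≫ e.hom) (e.inv ≫ g') h' ∈ distTriang C :=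
    isomorphic_distinguished _ hT' _
      (Triangle.isoMk _ _ (Iso.refl (A⟦(d : ℤ)⟧)) e.symm (Iso.refl (B⟦(d : ℤ)⟧))
        (by
          change (f' ≫ e.hom) ≫ e.inv = 𝟙 _ ≫ f'
          simp)
        (by
          change (e.inv ≫ g') ≫ 𝟙 _ = e.inv ≫ g'
          simp)
        (by
          change h' ≫ (𝟙 _)⟦(1 : ℤ)⟧' = 𝟙 _ ≫ h'
          simp))
  have hA' : (A⟦(d : ℤ)⟧)⟦-(d : ℤ)⟧ ∈ leZeroSet P :=
    hP.iso_le _ _ ((shiftFunctorCompIsoId C (d : ℤ) (-(d : ℤ)) (by simp)).app A).symm hA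
  refine ⟨B⟦(d : ℤ)⟧, ⟨fun Q hQ i hi => ?_, ?_⟩, A⟦(d : ℤ)⟧, _, _, _, hT'', hA'⟩
  · exact HomZero.obj₃ hT'' (hS Q hQ i hi)
      ((HomZero.shift_iff rfl).2 (hA Q hQ (d + (i + 1)) (by omega)))
  · exact hP.iso_ge _ _ ((shiftFunctorAdd' C (d : ℤ) (1 - d) 1 (by ring)).app B) hB

lemma IsHTrunc.hom_shift_one_eq_zero {P : Set C} {d : ℕ}
    (hP : IsTStr (leZeroSet P) (geZeroSet P)) {S M X : C} (h : IsHTrunc P d S M)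
    (hX : X ∈ extHeart P d) (hSX : HomZero S X 1) (f : M ⟶ X⟦(1 : ℤ)⟧) : f = 0 := by
  obtain ⟨_, W, a, b, c, hT, hW⟩ := h
  obtain ⟨g, rfl⟩ := Triangle.yoneda_exact₃ _ hT f (hSX _)
  change W⟦(1 : ℤ)⟧ ⟶ X⟦(1 : ℤ)⟧ at g
  have hg : g = 0 := by
    obtain ⟨g, rfl⟩ := (shiftFunctor C (1 : ℤ)).map_surjective g
    rw [hom_eq_zero_of_tStr hP hW hX g, Functor.map_zero]
  change c ≫ g = 0
  rw [hg, comp_zero]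

lemma hom_eq_zero_of_addClos {𝒮 : Set C} {Y : C} (h : ∀ M ∈ 𝒮, ∀ f : M ⟶ Y, f = 0)
    {M : C} (hM : AddClos 𝒮 M) (f : M ⟶ Y) : f = 0 := by
  induction hM with
  | of M hM => exact h M hM f
  | zero M hM => exact hM.eq_of_src _ _
  | biprod X Y Z i₁ i₂ p₁ p₂ _ _ _ _ htot _ _ hX hY =>
    rw [← Category.id_comp f, ← htot, Preadditive.add_comp, Category.assoc, Category.assoc,
      hX (i₁ ≫ f), hY (i₂ ≫ f), comp_zero, comp_zero, add_zero]
  | summand X Y i r hir _ hY =>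
    rw [← Category.id_comp f, ← hir, Category.assoc, hY (r ≫ f), comp_zero]

lemma comp_factors_of_addClos {𝒮 : Set C} {Q H X : C} (π : H ⟶ X)
    (h : ∀ M ∈ 𝒮, ∀ (p : Q ⟶ M) (g : M ⟶ X), ∃ q : Q ⟶ H, q ≫ π = p ≫ g)
    {M : C} (hM : AddClos 𝒮 M) (p : Q ⟶ M) (g : M ⟶ X) : ∃ q : Q ⟶ H, q ≫ π = p ≫ g := by
  induction hM with
  | of M hM => exact h M hM p g
  | zero M hM => exact ⟨0, by rw [hM.eq_of_tgt p 0, zero_comp, zero_comp]⟩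
  | biprod X Y Z i₁ i₂ p₁ p₂ _ _ _ _ htot _ _ hX hY =>
    obtain ⟨q₁, h₁⟩ := hX (p ≫ p₁) (i₁ ≫ g)
    obtain ⟨q₂, h₂⟩ := hY (p ≫ p₂) (i₂ ≫ g)
    refine ⟨q₁ + q₂, ?_⟩
    calc (q₁ + q₂) ≫ π = p ≫ (p₁ ≫ i₁ + p₂ ≫ i₂) ≫ g := by
          rw [Preadditive.add_comp, h₁, h₂]; simp
      _ = p ≫ g := by rw [htot, Category.id_comp]
  | summand X Y i r hir _ hY =>
    obtain ⟨q, hq⟩ := hY (p ≫ i) (r ≫ g)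
    exact ⟨q, by rw [hq, Category.assoc, reassoc_of% hir]⟩

lemma IsAIRTiltingWrt.fac_subset_fac_succ {P : Set C} {d : ℕ} {ℳ 𝒮 : Set C}
    (h : IsAIRTiltingWrt P d ℳ 𝒮) (hPpre : IsPresilting P)
    (hP : IsTStr (leZeroSet P) (geZeroSet P)) (hd : 0 < d) :
    Fac P d ℳ d ⊆ Fac P d ℳ (d + 1) := by
  obtain ⟨⟨h𝒮, rfl⟩, hcf, hTF⟩ := h
  have hℳ : addSet (hTruncSet P d 𝒮) ⊆ extHeart P d :=
    addSet_subset_extHeart fun M ⟨_, _, hM⟩ => hM.1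
  have hℳT : addSet (hTruncSet P d 𝒮) ⊆ TClass P d 𝒮 :=
    hTF ▸ subset_fac (.zero _ (isZero_zero C)) hℳ d
  intro X hX
  have hXT : X ∈ TClass P d 𝒮 := hTF ▸ hX
  obtain ⟨S, φ, hS, hφ⟩ := hcf X
  obtain ⟨H, hSH⟩ := exists_isHTrunc (d := d) hP
    (intervalFrom_subset_leZeroSet hPpre d 0 le_rfl (h𝒮 hS))
  have hH : H ∈ addSet (hTruncSet P d 𝒮) := .of _ ⟨S, hS, hSH⟩
  obtain ⟨hHd, W, a, b, c, hT, hW⟩ := hSH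
  obtain ⟨π, rfl⟩ := Triangle.yoneda_exact₂ _ hT φ (hom_eq_zero_of_tStr hP hW hXT.1 _)
  change H ⟶ X at π
  change ∀ X' ∈ 𝒮, ∀ g : X' ⟶ X, ∃ h : X' ⟶ S, h ≫ b ≫ π = g at hφ
  -- every map from an object of `P` to `X` factors through `π`
  have hlift : ∀ Q ∈ P, ∀ f : Q ⟶ X, ∃ q : Q ⟶ H, q ≫ π = f := by
    intro Q hQ f
    obtain ⟨d, rfl⟩ := Nat.exists_eq_add_of_lt hd
    obtain ⟨Z, _, M, hM, hZ, _, _, u, v, w, hZMX⟩ :=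
      (show X ∈ Fac P _ _ (0 + d + 1) from hX)
    obtain ⟨p, rfl⟩ := Triangle.coyoneda_exact₃ _ hZMX f (hZ.1 Q hQ 1 one_pos _)
    refine comp_factors_of_addClos π ?_ hM p v
    rintro M' ⟨S', hS', _, W', a', b', c', hT', hW'⟩ p' g'
    have hW'Q : HomZero Q W' 1 :=
      (HomZero.of_iso ((shiftFunctorCompIsoId C _ _ (neg_add_cancel _)).app W').symm
        ((HomZero.shift_iff rfl).2 (hW' Q hQ _ (by omega))))
    obtain ⟨p'', rfl⟩ := Triangle.coyoneda_exact₃ _ hT' p' (hW'Q _)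
    obtain ⟨s, hs⟩ := hφ S' hS' (b' ≫ g')
    exact ⟨p'' ≫ s ≫ b, (Category.assoc _ _ _).trans (((p'' ≫= (Category.assoc _ _ _).trans hs)).trans
      (Category.assoc _ _ _).symm)⟩
  obtain ⟨N, ι, δ, hN⟩ := distinguished_cocone_triangle₁ π
  have hX' := mem_extHeart_iff.1 hXT.1
  have hH' := mem_extHeart_iff.1 hHd
  have hNd : N ∈ extHeart P d := by
    refine mem_extHeart_iff.2 ⟨fun Q hQ k hk => ?_, fun Q hQ k hk => ?_⟩
    · obtain rfl | hk' : k = 1 ∨ 0 < k - 1 := by omega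
      · exact HomZero.obj₁_of_lift hN (hH'.1 Q hQ 1 one_pos) (hlift Q hQ)
      · exact HomZero.obj₁ hN (hX'.1 Q hQ _ hk') (hH'.1 Q hQ k hk)
    · exact HomZero.obj₁ hN (hX'.2 Q hQ _ (by omega)) (hH'.2 Q hQ k hk)
  have hNT : N ∈ TClass P d 𝒮 := by
    refine ⟨hNd, fun A hA k hk => ?_⟩
    obtain rfl | hk' : k = 1 ∨ 0 < k - 1 := by omega
    · refine HomZero.obj₁_of_lift hN ((hℳT hH).2 A hA 1 one_pos) fun f => ?_
      obtain ⟨s, hs⟩ := hφ A hA f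
      exact ⟨s ≫ b, (Category.assoc _ _ _).trans hs⟩
    · exact HomZero.obj₁ hN (hXT.2 A hA _ hk') ((hℳT hH).2 A hA k hk)
  exact ⟨N, hTF ▸ hNT, H, hH, hNd, hHd, hXT.1, ι, π, δ, hN⟩

theorem statement13
    (P : Set C) (hPpre : IsPresilting P) (m : ℤ) (hm : m < 0)
    (hP1 : ∀ X ∈ P, ∀ Y ∈ P, ∀ i : ℤ, i < m → ∀ f : X ⟶ Y⟦i⟧, f = 0)
    (hP2 : IsTStr (leZeroSet P) (geZeroSet P))
    (d : ℕ) (hd : 0 < d) :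
    ∀ ℳ : Set C, IsAIRTilting P d ℳ → IsQuasiTilting P d ℳ := by
  rintro ℳ ⟨𝒮, h𝒮⟩
  refine ⟨fun M hM X hX => ?_, (h𝒮.fac_subset_fac_succ hPpre hP2 hd).antisymm (fac_succ_subset d)⟩
  obtain ⟨⟨-, rfl⟩, -, hTF⟩ := h𝒮
  rw [← hTF] at hX
  refine hom_eq_zero_of_addClos ?_ hM
  rintro M' ⟨S, hS, hSM⟩
  exact hSM.hom_shift_one_eq_zero hP2 hX.1 (hX.2 S hS 1 one_pos)

end PaperAIR
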